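/- Let 0 < α < ω₁ and let X be a topological space. Then every ambiguously α-embedded subset E of X is α-embedded in X. -/

import Mathlib

open Set

universe u v

/-- `A` is functionally open in `X`: `A = f⁻¹((0,1])` for some continuous `f : X → [0,1]`. -/
def FunctionallyOpen (X : Type u) [TopologicalSpace X] (A : Set X) : Prop :=
  ∃ f : X → ℝ, Continuous f ∧ (∀ x, f x ∈ Set.Icc (0:ℝ) 1) ∧ A = f ⁻¹' (Set.Ioc 0 1)

/-- `A` is functionally closed in `X`: `A = f⁻¹(0)` for some continuous `f : X → [0,1]`. -/
def FunctionallyClosed (X : Type u) [TopologicalSpace X] (A : Set X) : Prop :=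
  ∃ f : X → ℝ, Continuous f ∧ (∀ x, f x ∈ Set.Icc (0:ℝ) 1) ∧ A = f ⁻¹' {0}

mutual
/-- The `α`'th functionally additive class in `X`. -/
inductive FunAdd (X : Type u) [TopologicalSpace X] : Ordinal.{0} → Set X → Prop where
  | base (A : Set X) : FunctionallyOpen X A → FunAdd X 0 A
  | union (α : Ordinal.{0}) (hα : α ≠ 0) (β : ℕ → Ordinal.{0}) (hβ : ∀ n, β n < α)
      (s : ℕ → Set X) (hs : ∀ n, FunMul X (β n) (s n)) : FunAdd X α (⋃ n, s n)

/-- The `α`'th functionally multiplicative class in `X`. -/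
inductive FunMul (X : Type u) [TopologicalSpace X] : Ordinal.{0} → Set X → Prop where
  | base (A : Set X) : FunctionallyClosed X A → FunMul X 0 A
  | inter (α : Ordinal.{0}) (hα : α ≠ 0) (β : ℕ → Ordinal.{0}) (hβ : ∀ n, β n < α)
      (s : ℕ → Set X) (hs : ∀ n, FunAdd X (β n) (s n)) : FunMul X α (⋂ n, s n)
end

mutual
/-- The `α`'th (ordinary) additive Borel class in `X`. -/
inductive BorelAdd (X : Type u) [TopologicalSpace X] : Ordinal.{0} → Set X → Prop where
  | base (A : Set X) : IsOpen A → BorelAdd X 0 A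
  | union (α : Ordinal.{0}) (hα : α ≠ 0) (β : ℕ → Ordinal.{0}) (hβ : ∀ n, β n < α)
      (s : ℕ → Set X) (hs : ∀ n, BorelMul X (β n) (s n)) : BorelAdd X α (⋃ n, s n)

/-- The `α`'th (ordinary) multiplicative Borel class in `X`. -/
inductive BorelMul (X : Type u) [TopologicalSpace X] : Ordinal.{0} → Set X → Prop where
  | base (A : Set X) : IsClosed A → BorelMul X 0 A
  | inter (α : Ordinal.{0}) (hα : α ≠ 0) (β : ℕ → Ordinal.{0}) (hβ : ∀ n, β n < α)
      (s : ℕ → Set X) (hs : ∀ n, BorelAdd X (β n) (s n)) : BorelMul X α (⋂ n, s n)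
end

/-- A set is functionally ambiguous of class `α` if it belongs to both the `α`'th functionally
additive and the `α`'th functionally multiplicative class. -/
def FunAmbiguous (X : Type u) [TopologicalSpace X] (α : Ordinal.{0}) (A : Set X) : Prop :=
  FunAdd X α A ∧ FunMul X α A

/-- `f ∈ K_α(X,Y)`: for `α = 0` continuity, for `α > 0` preimages of open sets belong to
the `α`'th functionally additive class. -/
def KClass {X : Type u} {Y : Type v} [TopologicalSpace X] [TopologicalSpace Y]
    (α : Ordinal.{0}) (f : X → Y) : Prop :=
  (α = 0 → Continuous f) ∧ (α ≠ 0 → ∀ V : Set Y, IsOpen V → FunAdd X α (f ⁻¹' V))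

/-- `A` and `B` are `α`-separated in `X`. -/
def AlphaSeparated {X : Type u} [TopologicalSpace X] (α : Ordinal.{0}) (A B : Set X) : Prop :=
  ∃ f : X → ℝ, KClass α f ∧ A ⊆ f ⁻¹' {0} ∧ B ⊆ f ⁻¹' {1}

/-- `X` is an `α`-separated space: any two disjoint sets of the `α`'th (ordinary)
multiplicative class are `α`-separated. -/
def AlphaSeparatedSpace (X : Type u) [TopologicalSpace X] (α : Ordinal.{0}) : Prop :=
  ∀ A B : Set X, BorelMul X α A → BorelMul X α B → Disjoint A B → AlphaSeparated α A B

/-- `E` is `α`-embedded in `X`. -/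
def AlphaEmbedded {X : Type u} [TopologicalSpace X] (α : Ordinal.{0}) (E : Set X) : Prop :=
  (∀ A : Set ↥E, FunAdd ↥E α A → ∃ B : Set X, FunAdd X α B ∧ Subtype.val '' A = B ∩ E) ∧
  (∀ A : Set ↥E, FunMul ↥E α A → ∃ B : Set X, FunMul X α B ∧ Subtype.val '' A = B ∩ E)

/-- `E` is ambiguously `α`-embedded in `X`. -/
def AmbiguouslyEmbedded {X : Type u} [TopologicalSpace X] (α : Ordinal.{0}) (E : Set X) : Prop :=
  ∀ A : Set ↥E, FunAmbiguous ↥E α A →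
    ∃ B : Set X, FunAmbiguous X α B ∧ Subtype.val '' A = B ∩ E

/-- The first uncountable ordinal. -/
noncomputable def omega1 : Ordinal.{0} := (Cardinal.aleph 1).ord

/-- `A` is an `F_σ`-set: a countable union of closed sets. -/
def IsFSigma {X : Type u} [TopologicalSpace X] (A : Set X) : Prop :=
  ∃ F : ℕ → Set X, (∀ n, IsClosed (F n)) ∧ A = ⋃ n, F n

/-- A space has a countable π-base. -/
def CountablePiBase (Z : Type v) [TopologicalSpace Z] : Prop :=
  ∃ 𝒰 : Set (Set Z), 𝒰.Countable ∧ (∀ U ∈ 𝒰, IsOpen U ∧ U.Nonempty) ∧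
    ∀ V : Set Z, IsOpen V → V.Nonempty → ∃ U ∈ 𝒰, U ⊆ V

section helpers
variable {X : Type u} [TopologicalSpace X]

lemma funAdd_inv {α : Ordinal.{0}} {A : Set X} (h : FunAdd X α A) (h0 : α ≠ 0) :
    ∃ (β : ℕ → Ordinal.{0}) (s : ℕ → Set X), (∀ n, β n < α) ∧ (∀ n, FunMul X (β n) (s n)) ∧
      A = ⋃ n, s n := by
  cases h with
  | base _ _ => exact absurd rfl h0
  | union => exact ⟨_, _, by assumption, by assumption, rfl⟩

lemma funMul_inv {α : Ordinal.{0}} {A : Set X} (h : FunMul X α A) (h0 : α ≠ 0) :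
    ∃ (β : ℕ → Ordinal.{0}) (s : ℕ → Set X), (∀ n, β n < α) ∧ (∀ n, FunAdd X (β n) (s n)) ∧
      A = ⋂ n, s n := by
  cases h with
  | base _ _ => exact absurd rfl h0
  | inter => exact ⟨_, _, by assumption, by assumption, rfl⟩

lemma funMul_mono {α β : Ordinal.{0}} {A : Set X} (h : FunMul X β A) (hb : β < α) :
    FunMul X α A := by
  have hα : α ≠ 0 := (lt_of_le_of_lt (zero_le) hb).ne'
  by_cases h0 : β = 0
  · subst h0
    have hc : FunctionallyClosed X A := by
      cases h with
      | base => assumption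
      | inter => exact absurd rfl (by assumption)
    obtain ⟨f, hf, hI, rfl⟩ := hc
    have e : f ⁻¹' {0} = ⋂ n : ℕ, {x | f x < 1 / ((n:ℝ) + 1)} := by
      ext x
      simp only [mem_preimage, mem_singleton_iff, mem_iInter, mem_ofPred_eq]
      constructor
      · intro hx n; rw [hx]; positivity
      · intro hx
        by_contra hne
        obtain ⟨n, hn⟩ := exists_nat_one_div_lt (lt_of_le_of_ne (hI x).1 (Ne.symm hne))
        exact absurd (hx n) (not_lt.2 hn.le)
    rw [e]
    refine FunMul.inter α hα (fun _ => 0) (fun _ => hb) _ fun n => FunAdd.base _ ?_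
    have hp : (0:ℝ) < 1 / ((n:ℝ) + 1) := by positivity
    have hp1 : 1 / ((n:ℝ) + 1) ≤ 1 := by
      rw [div_le_one (by positivity)]; linarith [(Nat.cast_nonneg n : (0:ℝ) ≤ n)]
    refine ⟨fun x => max 0 (1 / ((n:ℝ) + 1) - f x), by fun_prop, fun x => ⟨le_max_left _ _, ?_⟩, ?_⟩
    · exact max_le zero_le_one (by linarith [(hI x).1])
    · ext x
      simp only [mem_ofPred_eq, mem_preimage, mem_Ioc, lt_max_iff, lt_irrefl, false_or, sub_pos]
      exact ⟨fun h => ⟨h, max_le zero_le_one (by linarith [(hI x).1])⟩, fun h => h.1⟩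
  · obtain ⟨γ, s, hγ, hs, rfl⟩ := funMul_inv h h0
    exact FunMul.inter α hα γ (fun n => (hγ n).trans hb) s hs

lemma funAdd_mono {α β : Ordinal.{0}} {A : Set X} (h : FunAdd X β A) (hb : β < α) :
    FunAdd X α A := by
  have hα : α ≠ 0 := (lt_of_le_of_lt (zero_le) hb).ne'
  by_cases h0 : β = 0
  · subst h0
    have hc : FunctionallyOpen X A := by
      cases h with
      | base => assumption
      | union => exact absurd rfl (by assumption)
    obtain ⟨f, hf, hI, rfl⟩ := hc
    have e : f ⁻¹' (Ioc 0 1) = ⋃ n : ℕ, {x | 1 / ((n:ℝ) + 1) ≤ f x} := by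
      ext x
      simp only [mem_preimage, mem_Ioc, mem_iUnion, mem_ofPred_eq]
      constructor
      · intro hx
        obtain ⟨n, hn⟩ := exists_nat_one_div_lt hx.1
        exact ⟨n, hn.le⟩
      · rintro ⟨n, hn⟩
        exact ⟨lt_of_lt_of_le (by positivity) hn, (hI x).2⟩
    rw [e]
    refine FunAdd.union α hα (fun _ => 0) (fun _ => hb) _ fun n => FunMul.base _ ?_
    have hp1 : 1 / ((n:ℝ) + 1) ≤ 1 := by
      rw [div_le_one (by positivity)]; linarith [(Nat.cast_nonneg n : (0:ℝ) ≤ n)]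
    refine ⟨fun x => max 0 (1 / ((n:ℝ) + 1) - f x), by fun_prop, fun x => ⟨le_max_left _ _, ?_⟩, ?_⟩
    · exact max_le zero_le_one (by linarith [(hI x).1])
    · ext x
      simp only [mem_ofPred_eq, mem_preimage, mem_singleton_iff, max_eq_left_iff, sub_nonpos]
  · obtain ⟨γ, s, hγ, hs, rfl⟩ := funAdd_inv h h0
    exact FunAdd.union α hα γ (fun n => (hγ n).trans hb) s hs

lemma funAdd_of_funMul {α β : Ordinal.{0}} {A : Set X} (h : FunMul X β A) (hb : β < α) :
    FunAdd X α A := by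
  have hα : α ≠ 0 := (lt_of_le_of_lt (zero_le) hb).ne'
  have := FunAdd.union α hα (fun _ => β) (fun _ => hb) (fun _ => A) fun _ => h
  rwa [iUnion_const] at this

lemma funMul_of_funAdd {α β : Ordinal.{0}} {A : Set X} (h : FunAdd X β A) (hb : β < α) :
    FunMul X α A := by
  have hα : α ≠ 0 := (lt_of_le_of_lt (zero_le) hb).ne'
  have := FunMul.inter α hα (fun _ => β) (fun _ => hb) (fun _ => A) fun _ => h
  rwa [iInter_const] at this

lemma funAdd_iUnion {α : Ordinal.{0}} (hα : α ≠ 0) {s : ℕ → Set X} (h : ∀ n, FunAdd X α (s n)) :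
    FunAdd X α (⋃ n, s n) := by
  choose β t hβ ht e using fun n => funAdd_inv (h n) hα
  have := FunAdd.union α hα (fun k => β k.unpair.1 k.unpair.2) (fun k => hβ _ _)
    (fun k => t k.unpair.1 k.unpair.2) (fun k => ht _ _)
  rwa [iUnion_unpair t, ← iUnion_congr e] at this

lemma funMul_iInter {α : Ordinal.{0}} (hα : α ≠ 0) {s : ℕ → Set X} (h : ∀ n, FunMul X α (s n)) :
    FunMul X α (⋂ n, s n) := by
  choose β t hβ ht e using fun n => funMul_inv (h n) hα
  have := FunMul.inter α hα (fun k => β k.unpair.1 k.unpair.2) (fun k => hβ _ _)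
    (fun k => t k.unpair.1 k.unpair.2) (fun k => ht _ _)
  have e2 : ⋂ k : ℕ, t k.unpair.1 k.unpair.2 = ⋂ n, s n := by
    ext x
    simp only [e, mem_iInter]
    exact ⟨fun h i j => by simpa using h (Nat.pair i j), fun h k => h _ _⟩
  rwa [e2] at this

lemma val_image_eq_iff {E : Set X} (A : Set ↥E) (B : Set X) :
    Subtype.val '' A = B ∩ E ↔ A = Subtype.val ⁻¹' B := by
  constructor
  · intro h
    ext x
    have := Set.ext_iff.1 h x
    simpa using this
  · rintro rfl
    rw [Subtype.image_preimage_coe, inter_comm]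

end helpers

/-- every ambiguously `α`-embedded set is `α`-embedded (`0 < α < ω₁`). -/
theorem stmt8 {X : Type u} [TopologicalSpace X] (α : Ordinal.{0}) (hα0 : 0 < α)
    (hα : α < omega1) (E : Set X) (hE : AmbiguouslyEmbedded α E) :
    AlphaEmbedded α E := by
  have h0 : α ≠ 0 := hα0.ne'
  constructor
  · intro A hA
    obtain ⟨β, s, hβ, hs, rfl⟩ := funAdd_inv hA h0
    choose B hB e using fun n =>
      hE (s n) ⟨funAdd_of_funMul (hs n) (hβ n), funMul_mono (hs n) (hβ n)⟩
    refine ⟨⋃ n, B n, funAdd_iUnion h0 fun n => (hB n).1, ?_⟩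
    rw [val_image_eq_iff, preimage_iUnion]
    exact iUnion_congr fun n => (val_image_eq_iff _ _).1 (e n)
  · intro A hA
    obtain ⟨β, s, hβ, hs, rfl⟩ := funMul_inv hA h0
    choose B hB e using fun n =>
      hE (s n) ⟨funAdd_mono (hs n) (hβ n), funMul_of_funAdd (hs n) (hβ n)⟩
    refine ⟨⋂ n, B n, funMul_iInter h0 fun n => (hB n).2, ?_⟩
    rw [val_image_eq_iff, preimage_iInter]
    exact iInter_congr fun n => (val_image_eq_iff _ _).1 (e n)
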